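/- arXiv:1109.1174 — 2 statements merged into one kernel-verified Lean document; each statement's English description precedes it below -/
import Mathlib

section
/- Let α ∈ 𝒟𝒮. There exist a 2-Cantor tree T and a T-assignment f into ℝ which is regular and satisfies the 3-intersection condition, such that [f] = K_α. -/
open Set Filter Topology TopologicalSpace ENNReal MeasureTheory

/-- The set `D` of dyadic rationals in `(0,1)`. -/
def dyadics : Set ℝ :=
  {x : ℝ | ∃ i k : ℕ, 0 < i ∧ 0 < k ∧ i < 2 ^ k ∧ x = (i : ℝ) / 2 ^ k}

/-- `φ ∈ 𝒢`: a "gap function", i.e. `φ : D → (0,1)` with `∑_{d ∈ D} φ d = 1`. -/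
def IsGapFun (φ : ℝ → ℝ) : Prop :=
  (∀ d ∈ dyadics, φ d ∈ Set.Ioo (0 : ℝ) 1) ∧ HasSum (fun d : dyadics => φ d) 1

/-- `Φ(d) = ∑_{d' ∈ D, d' < d} φ(d')`. -/
noncomputable def PhiFun (φ : ℝ → ℝ) (d : ℝ) : ℝ :=
  ∑' d' : ↥(dyadics ∩ Set.Iio d), φ d'

/-- `K_φ = [0,1] \ ⋃_{d ∈ D} (Φ(d), Φ(d) + φ(d))`. -/
noncomputable def Kset (φ : ℝ → ℝ) : Set ℝ :=
  Set.Icc 0 1 \ ⋃ d ∈ dyadics, Set.Ioo (PhiFun φ d) (PhiFun φ d + φ d)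

/-- A tree on `ℕ`: a set of finite sequences closed under initial segments. -/
def IsTree (T : Set (List ℕ)) : Prop :=
  ∀ σ ∈ T, ∀ τ : List ℕ, τ <+: σ → τ ∈ T

/-- The body `[T]` of a tree: all infinite branches. -/
def treeBody (T : Set (List ℕ)) : Set (ℕ → ℕ) :=
  {σ | ∀ n : ℕ, (List.ofFn fun i : Fin n => σ i) ∈ T}

/-- A Cantor tree: every node has finite valency at least 2. -/
def IsCantorTree (T : Set (List ℕ)) : Prop :=
  IsTree T ∧ ∀ σ ∈ T, {m : ℕ | σ ++ [m] ∈ T}.Finite ∧ 2 ≤ {m : ℕ | σ ++ [m] ∈ T}.ncard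

/-- An `n`-Cantor tree: every node has valency exactly `n`. -/
def IsNCantorTree (n : ℕ) (T : Set (List ℕ)) : Prop :=
  IsTree T ∧ ∀ σ ∈ T, {m : ℕ | σ ++ [m] ∈ T}.Finite ∧ {m : ℕ | σ ++ [m] ∈ T}.ncard = n

/-- A `T`-assignment into a metric space `X`. -/
def IsAssignment {X : Type*} [MetricSpace X] (T : Set (List ℕ)) (f : List ℕ → Set X) : Prop :=
  (∀ σ ∈ T, IsOpen (f σ) ∧ (f σ).Nonempty) ∧
  (∀ σ ∈ T, EMetric.diam (f σ) < 1 / (σ.length : ℝ≥0∞)) ∧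
  (∀ σ ∈ T, ∀ τ ∈ T, σ ≠ τ → σ.length = τ.length → Disjoint (f σ) (f τ)) ∧
  (∀ σ ∈ T, ∀ τ ∈ T, σ <+: τ → σ ≠ τ → closure (f τ) ⊆ f σ)

/-- `[f] = ⋃_{σ ∈ [T]} ⋂_{n ≥ 1} closure (f (σ|n))`. -/
def limitSet {X : Type*} [MetricSpace X] (T : Set (List ℕ)) (f : List ℕ → Set X) : Set X :=
  ⋃ σ ∈ treeBody T, ⋂ n : ℕ, closure (f (List.ofFn fun i : Fin (n + 1) => σ i))

/-- `f` is a regular `T`-assignment: every diameter at level `n+1` is smaller than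
every diameter at level `n`. -/
def IsRegularAssignment {X : Type*} [MetricSpace X] (T : Set (List ℕ))
    (f : List ℕ → Set X) : Prop :=
  ∀ σ ∈ T, ∀ τ ∈ T, σ.length = τ.length + 1 → EMetric.diam (f σ) < EMetric.diam (f τ)

/-- `f` satisfies the `l`-intersection condition: whenever an open ball meets at least `l`
of the level-`n` sets, it contains the closure of some level-`n` set. -/
def IntersectionCond {X : Type*} [MetricSpace X] (l : ℕ) (T : Set (List ℕ))
    (f : List ℕ → Set X) : Prop :=
  ∀ (n : ℕ) (x : X) (r : ℝ) (S : Finset (List ℕ)),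
    (∀ σ ∈ S, σ ∈ T ∧ σ.length = n ∧ (Metric.ball x r ∩ f σ).Nonempty) →
    l ≤ S.card →
    ∃ σ ∈ T, σ.length = n ∧ closure (f σ) ⊆ Metric.ball x r

/-- `α ∈ 𝒟𝒮`: a decreasing sequence of positive reals (indexed from 1) summing to 1. -/
def IsGapSeq (α : ℕ → ℝ) : Prop :=
  (∀ i, 1 ≤ i → 0 < α i) ∧ (∀ i j, 1 ≤ i → i ≤ j → α j ≤ α i) ∧
    HasSum (fun i : ℕ => α (i + 1)) 1

/-- `φ` is the gap function associated to the gap sequence `α`: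
`φ((2s+1)/2^j) = α(2^(j-1) + s)` for `j ≥ 1`, `0 ≤ s < 2^(j-1)`. -/
def IsGapFunOf (α : ℕ → ℝ) (φ : ℝ → ℝ) : Prop :=
  ∀ j s : ℕ, 1 ≤ j → s < 2 ^ (j - 1) →
    φ ((2 * (s : ℝ) + 1) / 2 ^ j) = α (2 ^ (j - 1) + s)

/-! ### Dyadic rationals -/

lemma odd_div_mem_dyadics {j u : ℕ} (hu : u < 2 ^ j) :
    (2 * (u : ℝ) + 1) / 2 ^ (j + 1) ∈ dyadics :=
  ⟨2 * u + 1, j + 1, by omega, by omega, by rw [pow_succ]; omega, by push_cast; rfl⟩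

/-- A dyadic rational `i / 2 ^ k` in `(0,1)` in lowest terms. -/
lemma exists_odd_div_eq {i k : ℕ} (hi : 0 < i) (hik : i < 2 ^ k) :
    ∃ j u : ℕ, j < k ∧ u < 2 ^ j ∧ (i : ℝ) / 2 ^ k = (2 * (u : ℝ) + 1) / 2 ^ (j + 1) := by
  induction k generalizing i with
  | zero => simp at hik; omega
  | succ k ih =>
    rcases Nat.even_or_odd' i with ⟨v, rfl | rfl⟩
    · obtain ⟨j, u, hj, hu, h⟩ := ih (i := v) (by omega) (by rw [pow_succ] at hik; omega)
      refine ⟨j, u, by omega, hu, ?_⟩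
      rw [← h]
      push_cast
      field_simp
      ring
    · exact ⟨k, v, by omega, by rw [pow_succ] at hik; omega, by push_cast; rfl⟩

lemma div_mem_dyadics {i k : ℕ} (hi : 0 < i) (hik : i < 2 ^ k) : (i : ℝ) / 2 ^ k ∈ dyadics := by
  refine ⟨i, k, hi, ?_, hik, rfl⟩
  rcases Nat.eq_zero_or_pos k with rfl | h
  · simp at hik; omega
  · exact h

lemma le_gapFun_div {φ : ℝ → ℝ} {α : ℕ → ℝ} (hα : IsGapSeq α) (hφα : IsGapFunOf α φ) {i k : ℕ}
    (hi : 0 < i) (hik : i < 2 ^ k) : α (2 ^ k) ≤ φ ((i : ℝ) / 2 ^ k) := by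
  obtain ⟨j, u, hj, hu, h⟩ := exists_odd_div_eq hi hik
  rw [h, hφα (j + 1) u (by omega) (by simpa using hu), Nat.add_sub_cancel]
  have h1 : 0 < 2 ^ j := by positivity
  have h2 : 2 ^ (j + 1) ≤ 2 ^ k := Nat.pow_le_pow_right (by omega) hj
  exact hα.2.1 _ _ (by omega) (by rw [pow_succ] at h2; omega)

/-! ### The mass of a gap function -/

/-- The total size of the gaps indexed by the dyadic rationals in `S`. -/
noncomputable def gapMass (φ : ℝ → ℝ) (S : Set ℝ) : ℝ := ∑' d : ↥(dyadics ∩ S), φ d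

section GapMass

variable {φ : ℝ → ℝ}

lemma IsGapFun.summable (hφ : IsGapFun φ) (S : Set ℝ) :
    Summable fun d : ↥(dyadics ∩ S) => φ d :=
  hφ.2.summable.comp_injective (i := Set.inclusion Set.inter_subset_left)
    (Set.inclusion_injective _)

lemma gapMass_nonneg (hφ : IsGapFun φ) (S : Set ℝ) : 0 ≤ gapMass φ S :=
  tsum_nonneg fun d => (hφ.1 d d.2.1).1.le

lemma gapMass_union (hφ : IsGapFun φ) {S T : Set ℝ} (h : Disjoint S T) :
    gapMass φ (S ∪ T) = gapMass φ S + gapMass φ T := by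
  unfold gapMass
  rw [Set.inter_union_distrib_left]
  exact Summable.tsum_union_disjoint (f := φ)
    (h.mono Set.inter_subset_right Set.inter_subset_right) (hφ.summable S) (hφ.summable T)

lemma gapMass_mono (hφ : IsGapFun φ) {S T : Set ℝ} (h : S ⊆ T) : gapMass φ S ≤ gapMass φ T := by
  rw [← Set.union_sdiff_cancel h, gapMass_union hφ Set.disjoint_sdiff_right]
  linarith [gapMass_nonneg hφ (T \ S)]

lemma gapMass_singleton {d : ℝ} (hd : d ∈ dyadics) : gapMass φ {d} = φ d := by
  unfold gapMass
  rw [Set.inter_eq_right.2 (Set.singleton_subset_iff.2 hd)]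
  exact tsum_singleton d φ

lemma gapMass_Iic_zero : gapMass φ (Iic 0) = 0 := by
  have : dyadics ∩ Iic 0 = ∅ := by
    ext x
    simp only [mem_inter_iff, mem_Iic, mem_empty_iff_false, iff_false, not_and, not_le]
    rintro ⟨i, k, hi, -, -, rfl⟩
    positivity
  unfold gapMass
  rw [this]
  exact tsum_empty

lemma gapMass_Iio_one (hφ : IsGapFun φ) : gapMass φ (Iio 1) = 1 := by
  have : dyadics ∩ Iio 1 = dyadics := by
    refine Set.inter_eq_left.2 ?_
    rintro x ⟨i, k, -, -, hi, rfl⟩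
    rw [mem_Iio, div_lt_one (by positivity)]
    exact_mod_cast hi
  unfold gapMass
  rw [this]
  exact hφ.2.tsum_eq

lemma gapMass_Iic (hφ : IsGapFun φ) {d : ℝ} (hd : d ∈ dyadics) :
    gapMass φ (Iic d) = gapMass φ (Iio d) + φ d := by
  rw [← Iio_union_right, gapMass_union hφ (by simp), gapMass_singleton hd]

lemma gapMass_Iio (hφ : IsGapFun φ) {x y : ℝ} (h : x < y) :
    gapMass φ (Iio y) = gapMass φ (Iic x) + gapMass φ (Ioo x y) := by
  rw [← Iic_union_Ioo_eq_Iio h, gapMass_union hφ]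
  exact Set.disjoint_left.2 fun z hz hz' => not_lt.2 hz hz'.1

end GapMass

/-! ### Dyadic cells -/

/-- Left endpoint of the component of `[0,1]` minus the gaps of level at most `n` that corresponds
to the dyadic interval `(s / 2 ^ n, (s + 1) / 2 ^ n)`. -/
noncomputable def cellLeft (φ : ℝ → ℝ) (n s : ℕ) : ℝ := gapMass φ (Iic ((s : ℝ) / 2 ^ n))

/-- Right endpoint of the component of `[0,1]` minus the gaps of level at most `n` that corresponds
to the dyadic interval `(s / 2 ^ n, (s + 1) / 2 ^ n)`. -/
noncomputable def cellRight (φ : ℝ → ℝ) (n s : ℕ) : ℝ := gapMass φ (Iio (((s : ℝ) + 1) / 2 ^ n))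

/-- Length of the component of `[0,1]` minus the gaps of level at most `n` that corresponds
to the dyadic interval `(s / 2 ^ n, (s + 1) / 2 ^ n)`. -/
noncomputable def cellLength (φ : ℝ → ℝ) (n s : ℕ) : ℝ :=
  gapMass φ (Ioo ((s : ℝ) / 2 ^ n) (((s : ℝ) + 1) / 2 ^ n))

section Cell

variable {φ : ℝ → ℝ} {α : ℕ → ℝ}

lemma cellRight_eq (hφ : IsGapFun φ) (n s : ℕ) :
    cellRight φ n s = cellLeft φ n s + cellLength φ n s :=
  gapMass_Iio hφ (by gcongr; linarith)

lemma cellLength_nonneg (hφ : IsGapFun φ) (n s : ℕ) : 0 ≤ cellLength φ n s :=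
  gapMass_nonneg hφ _

lemma cellLeft_succ (hφ : IsGapFun φ) {n s : ℕ} (hs : s + 1 < 2 ^ n) :
    cellLeft φ n (s + 1) = cellRight φ n s + φ (((s + 1 : ℕ) : ℝ) / 2 ^ n) := by
  rw [cellLeft, gapMass_Iic hφ (div_mem_dyadics (by omega) hs), cellRight]
  push_cast
  rfl

lemma div_two_pow_succ (n s : ℕ) : (2 * (s : ℝ)) / 2 ^ (n + 1) = s / 2 ^ n := by
  rw [pow_succ]; field_simp

lemma cellLeft_two_mul (n s : ℕ) : cellLeft φ (n + 1) (2 * s) = cellLeft φ n s := by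
  rw [cellLeft, cellLeft, Nat.cast_mul, Nat.cast_two, div_two_pow_succ]

lemma cellRight_two_mul_add_one (n s : ℕ) :
    cellRight φ (n + 1) (2 * s + 1) = cellRight φ n s := by
  simp only [cellRight]
  have : (s : ℝ) + 1 = ((s + 1 : ℕ) : ℝ) := by push_cast; rfl
  rw [this, ← div_two_pow_succ]
  push_cast
  ring_nf

lemma cellLeft_le_cellLeft (hφ : IsGapFun φ) {n s t : ℕ} (h : s ≤ t) :
    cellLeft φ n s ≤ cellLeft φ n t :=
  gapMass_mono hφ (Iic_subset_Iic.2 (by gcongr))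

lemma cellRight_le_cellRight (hφ : IsGapFun φ) {n s t : ℕ} (h : s ≤ t) :
    cellRight φ n s ≤ cellRight φ n t :=
  gapMass_mono hφ (Iio_subset_Iio (by gcongr))

lemma cellLeft_le_child (hφ : IsGapFun φ) (n s b : ℕ) :
    cellLeft φ n s ≤ cellLeft φ (n + 1) (2 * s + b) :=
  cellLeft_two_mul (φ := φ) n s ▸ cellLeft_le_cellLeft hφ (by omega)

lemma cellRight_child_le (hφ : IsGapFun φ) (n s : ℕ) {b : ℕ} (hb : b < 2) :
    cellRight φ (n + 1) (2 * s + b) ≤ cellRight φ n s :=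
  cellRight_two_mul_add_one (φ := φ) n s ▸ cellRight_le_cellRight hφ (by omega)

lemma cellLeft_zero_zero : cellLeft φ 0 0 = 0 := by
  simp [cellLeft, gapMass_Iic_zero]

lemma cellRight_last (hφ : IsGapFun φ) {n s : ℕ} (hs : s + 1 = 2 ^ n) : cellRight φ n s = 1 := by
  have : (s : ℝ) + 1 = 2 ^ n := by exact_mod_cast hs
  rw [cellRight, this, div_self (by positivity), gapMass_Iio_one hφ]

/-- The affine correspondence between two dyadic intervals, on the level of gaps. -/
lemma cell_transfer (hα : IsGapSeq α) (hφα : IsGapFunOf α φ) {n s n' s' : ℕ} (hs : s < 2 ^ n)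
    (h : 2 ^ n + s ≤ 2 ^ n' + s') {d : ℝ}
    (hd : d ∈ dyadics ∩ Ioo ((s' : ℝ) / 2 ^ n') (((s' : ℝ) + 1) / 2 ^ n')) :
    ((s : ℝ) + (d * 2 ^ n' - s')) / 2 ^ n ∈
        dyadics ∩ Ioo ((s : ℝ) / 2 ^ n) (((s : ℝ) + 1) / 2 ^ n) ∧
      φ d ≤ φ (((s : ℝ) + (d * 2 ^ n' - s')) / 2 ^ n) := by
  obtain ⟨⟨i, k, hi, -, hik, rfl⟩, hl, hr⟩ := hd
  obtain ⟨j, u, -, hu, hd⟩ := exists_odd_div_eq hi hik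
  rw [hd] at hl hr ⊢
  have hn : n' ≤ j := by
    by_contra! hlt
    obtain ⟨m, rfl⟩ := Nat.exists_eq_add_of_lt hlt
    have e : (2 * (u : ℝ) + 1) / 2 ^ (j + 1) = ((2 * u + 1) * 2 ^ m) / 2 ^ (j + m + 1) := by
      field_simp
      ring
    rw [e] at hl hr
    rw [div_lt_div_iff_of_pos_right (by positivity)] at hl hr
    have h1 : s' < (2 * u + 1) * 2 ^ m := by exact_mod_cast hl
    have h2 : (2 * u + 1) * 2 ^ m < s' + 1 := by exact_mod_cast hr
    omega
  obtain ⟨m, rfl⟩ := Nat.exists_eq_add_of_le hn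
  have e (x : ℝ) : x / 2 ^ n' = (x * (2 * 2 ^ m)) / 2 ^ (n' + m + 1) := by
    field_simp
    ring
  have hl' := hl
  have hr' := hr
  rw [e, div_lt_div_iff_of_pos_right (by positivity)] at hl' hr'
  have h1 : s' * (2 * 2 ^ m) < 2 * u + 1 := by exact_mod_cast hl'
  have h2 : 2 * u + 1 < (s' + 1) * (2 * 2 ^ m) := by exact_mod_cast hr'
  obtain ⟨t, rfl⟩ : ∃ t, u = s' * 2 ^ m + t :=
    Nat.exists_eq_add_of_le (by linarith [show s' * 2 ^ m < u + 1 by linarith])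
  have ht : t < 2 ^ m := by linarith
  have hv : s * 2 ^ m + t < 2 ^ (n + m) := by
    have : (s + 1) * 2 ^ m ≤ 2 ^ n * 2 ^ m := Nat.mul_le_mul_right _ hs
    rw [pow_add]
    linarith
  have ed : ((s : ℝ) + ((2 * ((s' * 2 ^ m + t : ℕ) : ℝ) + 1) / 2 ^ (n' + m + 1) * 2 ^ n' - s'))
      / 2 ^ n = (2 * ((s * 2 ^ m + t : ℕ) : ℝ) + 1) / 2 ^ (n + m + 1) := by
    push_cast
    field_simp
    ring
  refine ⟨⟨?_, ?_, ?_⟩, ?_⟩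
  · rw [ed]
    exact odd_div_mem_dyadics hv
  · rw [div_lt_iff₀ (by positivity)] at hl
    gcongr
    linarith
  · rw [lt_div_iff₀ (by positivity)] at hr
    gcongr
    linarith
  · rw [ed, hφα _ _ (by omega) (by simpa using hu), hφα _ _ (by omega) (by simpa using hv)]
    have hp : 0 < 2 ^ (n + m) := by positivity
    refine hα.2.1 _ _ (by simp only [Nat.add_sub_cancel]; omega) ?_
    have := Nat.mul_le_mul_right (2 ^ m) h
    simp only [Nat.add_sub_cancel, pow_add]
    linarith

lemma cellLength_antitone (hα : IsGapSeq α) (hφ : IsGapFun φ) (hφα : IsGapFunOf α φ)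
    {n s n' s' : ℕ} (hs : s < 2 ^ n) (h : 2 ^ n + s ≤ 2 ^ n' + s') :
    cellLength φ n' s' ≤ cellLength φ n s := by
  refine Summable.tsum_le_tsum_of_inj
    (fun d => ⟨((s : ℝ) + ((d : ℝ) * 2 ^ n' - s')) / 2 ^ n, (cell_transfer hα hφα hs h d.2).1⟩)
    ?_ (fun c _ => (hφ.1 c c.2.1).1.le) (fun d => (cell_transfer hα hφα hs h d.2).2)
    (hφ.summable _) (hφ.summable _)
  intro d e hde
  have h1 := congrArg Subtype.val hde
  simp only at h1
  have h2 : (2 : ℝ) ^ n ≠ 0 := by positivity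
  have h3 : (2 : ℝ) ^ n' ≠ 0 := by positivity
  have h4 := (div_left_inj' h2).1 h1
  exact Subtype.ext (mul_right_cancel₀ h3 (by linarith))

/-- Each cell splits into two cells separated by a gap. -/
lemma cellLength_split (hφ : IsGapFun φ) {n s : ℕ} (hs : s < 2 ^ n) :
    cellLength φ n s = cellLength φ (n + 1) (2 * s) + φ (((2 * s + 1 : ℕ) : ℝ) / 2 ^ (n + 1)) +
      cellLength φ (n + 1) (2 * s + 1) := by
  have h1 := cellRight_eq hφ n s
  have h2 := cellRight_eq hφ (n + 1) (2 * s)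
  have h3 := cellRight_eq hφ (n + 1) (2 * s + 1)
  have h4 := cellLeft_succ hφ (n := n + 1) (s := 2 * s) (by rw [pow_succ]; omega)
  rw [cellLeft_two_mul] at h2
  rw [cellRight_two_mul_add_one] at h3
  linarith

lemma cellLength_pos (hφ : IsGapFun φ) {n s : ℕ} (hs : s < 2 ^ n) : 0 < cellLength φ n s := by
  rw [cellLength_split hφ hs]
  have h1 := cellLength_nonneg hφ (n + 1) (2 * s)
  have h2 := cellLength_nonneg hφ (n + 1) (2 * s + 1)
  have h3 := (hφ.1 _ (div_mem_dyadics (i := 2 * s + 1) (k := n + 1) (by omega)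
    (by rw [pow_succ]; omega))).1
  linarith

lemma lt_cellRight (hα : IsGapSeq α) (hφ : IsGapFun φ) (hφα : IsGapFunOf α φ) (n k : ℕ)
    (hk : k < 2 ^ n) :
    ((k : ℝ) + 1) * (cellLength φ (n + 1) 0 + α (2 ^ (n + 1))) < cellRight φ n k := by
  induction k with
  | zero =>
    have h1 := cellLength_split hφ (n := n) (s := 0) (by positivity)
    have h2 := cellLength_pos hφ (n := n + 1) (s := 1) (Nat.one_lt_two_pow (by omega))
    have h3 := le_gapFun_div hα hφα (i := 1) (k := n + 1) one_pos (Nat.one_lt_two_pow (by omega))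
    have h4 : 0 ≤ cellLeft φ n 0 := gapMass_nonneg hφ _
    have h5 := cellRight_eq hφ n 0
    norm_num at h1 h3 ⊢
    linarith
  | succ k ih =>
    have h1 := ih (by omega)
    have h2 := cellRight_eq hφ n (k + 1)
    have h3 := cellLeft_succ hφ hk
    have h4 := le_gapFun_div hα hφα (Nat.succ_pos k) hk
    have h5 : cellLength φ (n + 1) 0 ≤ cellLength φ n (k + 1) :=
      cellLength_antitone hα hφ hφα hk (by rw [pow_succ]; omega)
    have h6 : α (2 ^ (n + 1)) ≤ α (2 ^ n) :=
      hα.2.1 _ _ Nat.one_le_two_pow (Nat.pow_le_pow_right (by omega) (by omega))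
    push_cast at *
    linarith

lemma cellLength_add_lt (hα : IsGapSeq α) (hφ : IsGapFun φ) (hφα : IsGapFunOf α φ) (n s : ℕ) :
    cellLength φ (n + 1) s + α (2 ^ (n + 1)) < 1 / ((n : ℝ) + 1) := by
  obtain ⟨k, hk⟩ := Nat.exists_eq_add_of_lt (Nat.two_pow_pos n)
  have h1 := lt_cellRight hα hφ hφα n k (by omega)
  rw [cellRight_last hφ (by omega)] at h1
  have h2 : cellLength φ (n + 1) s ≤ cellLength φ (n + 1) 0 :=
    cellLength_antitone hα hφ hφα (by positivity) (by omega)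
  have h3 : n < k + 1 := by have := Nat.lt_two_pow_self (n := n); omega
  have h4 : (n : ℝ) + 1 ≤ k + 1 := by exact_mod_cast h3
  have h5 : 0 ≤ cellLength φ (n + 1) 0 + α (2 ^ (n + 1)) :=
    add_nonneg (cellLength_nonneg hφ _ _) (hα.1 _ Nat.one_le_two_pow).le
  rw [lt_div_iff₀ (by positivity)]
  have h6 := mul_le_mul_of_nonneg_right h4 h5
  have h7 := mul_le_mul_of_nonneg_left h2 (by positivity : (0 : ℝ) ≤ n + 1)
  linarith

end Cell

/-! ### The enlargement radii -/

/-- The amount by which the cells of level `n` are enlarged. -/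
noncomputable def radius (α : ℕ → ℝ) (n : ℕ) : ℝ := α (2 ^ n) * (1 / 2) ^ (n + 2)

section Radius

variable {α : ℕ → ℝ}

lemma radius_pos (hα : IsGapSeq α) (n : ℕ) : 0 < radius α n :=
  mul_pos (hα.1 _ Nat.one_le_two_pow) (by positivity)

lemma radius_succ_lt (hα : IsGapSeq α) (n : ℕ) : radius α (n + 1) < radius α n := by
  have h1 : α (2 ^ (n + 1)) ≤ α (2 ^ n) :=
    hα.2.1 _ _ Nat.one_le_two_pow (Nat.pow_le_pow_right (by omega) (by omega))
  have h2 := radius_pos hα n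
  have h3 : radius α (n + 1) ≤ α (2 ^ n) * (1 / 2) ^ (n + 1 + 2) := by
    unfold radius
    gcongr
  have h4 : α (2 ^ n) * (1 / 2) ^ (n + 1 + 2) = radius α n / 2 := by
    unfold radius
    ring
  linarith

lemma two_mul_radius_le (hα : IsGapSeq α) (n : ℕ) : 2 * radius α n ≤ α (2 ^ n) := by
  have h1 := hα.1 _ (Nat.one_le_two_pow (n := n))
  have h2 : ((1 : ℝ) / 2) ^ n ≤ 1 := pow_le_one₀ (by norm_num) (by norm_num)
  have h3 := mul_le_mul_of_nonneg_left h2 h1.le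
  have h4 : radius α n = α (2 ^ n) * (1 / 2) ^ n / 4 := by
    unfold radius
    ring
  linarith

lemma tendsto_radius (hα : IsGapSeq α) : Tendsto (radius α) atTop (𝓝 0) := by
  have h : Tendsto (fun n : ℕ => α 1 * (1 / 2 : ℝ) ^ (n + 2)) atTop (𝓝 (α 1 * 0)) :=
    ((tendsto_add_atTop_iff_nat 2).2
      (tendsto_pow_atTop_nhds_zero_of_lt_one (by norm_num) (by norm_num))).const_mul _
  rw [mul_zero] at h
  refine squeeze_zero (fun n => (radius_pos hα n).le) (fun n => ?_) h
  exact mul_le_mul_of_nonneg_right (hα.2.1 _ _ le_rfl Nat.one_le_two_pow) (by positivity)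

end Radius

/-! ### The binary tree and its assignment -/

/-- The tree of finite sequences of zeros and ones. -/
def binaryTree : Set (List ℕ) := {σ | ∀ b ∈ σ, b < 2}

/-- The number with binary expansion `σ`. -/
def binaryValue (σ : List ℕ) : ℕ := σ.foldl (fun v b => 2 * v + b) 0

/-- The enlarged cell of a finite binary sequence. -/
noncomputable def cellAssignment (α : ℕ → ℝ) (φ : ℝ → ℝ) (σ : List ℕ) : Set ℝ :=
  Ioo (cellLeft φ σ.length (binaryValue σ) - radius α σ.length)
    (cellRight φ σ.length (binaryValue σ) + radius α σ.length)

lemma binaryValue_append (σ : List ℕ) (b : ℕ) :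
    binaryValue (σ ++ [b]) = 2 * binaryValue σ + b := by
  simp [binaryValue]

lemma append_mem_binaryTree {σ : List ℕ} {b : ℕ} :
    σ ++ [b] ∈ binaryTree ↔ σ ∈ binaryTree ∧ b < 2 := by
  simp [binaryTree, or_imp, forall_and]

lemma binaryValue_lt {σ : List ℕ} (hσ : σ ∈ binaryTree) : binaryValue σ < 2 ^ σ.length := by
  induction σ using List.reverseRecOn with
  | nil => simp [binaryValue]
  | append_singleton σ b ih =>
    rw [append_mem_binaryTree] at hσ
    have := ih hσ.1
    rw [binaryValue_append, List.length_append, List.length_singleton, pow_succ]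
    omega

lemma binaryValue_injective {σ τ : List ℕ} (hσ : σ ∈ binaryTree) (hτ : τ ∈ binaryTree)
    (hl : σ.length = τ.length) (h : binaryValue σ = binaryValue τ) : σ = τ := by
  induction σ using List.reverseRecOn generalizing τ with
  | nil => exact (List.length_eq_zero_iff.1 hl.symm).symm
  | append_singleton σ b ih =>
    rcases List.eq_nil_or_concat' τ with rfl | ⟨τ, c, rfl⟩
    · simp at hl
    · rw [append_mem_binaryTree] at hσ hτ
      rw [binaryValue_append, binaryValue_append] at h
      rw [List.length_append, List.length_append] at hl
      rw [ih hσ.1 hτ.1 (by simpa using hl) (by omega), show b = c by omega]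

lemma isNCantorTree_binaryTree : IsNCantorTree 2 binaryTree := by
  refine ⟨fun σ hσ τ h b hb => hσ b (h.subset hb), fun σ hσ => ?_⟩
  have : {m : ℕ | σ ++ [m] ∈ binaryTree} = ((Finset.range 2 : Finset ℕ) : Set ℕ) := by
    ext m
    simp [append_mem_binaryTree, hσ]
  rw [this]
  exact ⟨Finset.finite_toSet _, by rw [Set.ncard_coe_finset, Finset.card_range]⟩

lemma ofFn_succ_eq_append (σ : ℕ → ℕ) (n : ℕ) :
    (List.ofFn fun i : Fin (n + 1) => σ i) = (List.ofFn fun i : Fin n => σ i) ++ [σ n] := by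
  rw [List.ofFn_succ']
  simp

section Assignment

variable {φ : ℝ → ℝ} {α : ℕ → ℝ}

lemma cellLeft_lt_cellRight (hφ : IsGapFun φ) {n s : ℕ} (hs : s < 2 ^ n) :
    cellLeft φ n s < cellRight φ n s := by
  have h1 := cellRight_eq hφ n s
  have h2 := cellLength_pos hφ hs
  linarith

lemma cellAssignment_endpoints_lt (hα : IsGapSeq α) (hφ : IsGapFun φ) {σ : List ℕ}
    (hσ : σ ∈ binaryTree) :
    cellLeft φ σ.length (binaryValue σ) - radius α σ.length <
      cellRight φ σ.length (binaryValue σ) + radius α σ.length := by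
  have h1 := cellLeft_lt_cellRight hφ (binaryValue_lt hσ)
  have h2 := radius_pos hα σ.length
  linarith

lemma closure_cellAssignment (hα : IsGapSeq α) (hφ : IsGapFun φ) {σ : List ℕ}
    (hσ : σ ∈ binaryTree) :
    closure (cellAssignment α φ σ) =
      Icc (cellLeft φ σ.length (binaryValue σ) - radius α σ.length)
        (cellRight φ σ.length (binaryValue σ) + radius α σ.length) :=
  closure_Ioo (cellAssignment_endpoints_lt hα hφ hσ).ne

lemma diam_cellAssignment (hφ : IsGapFun φ) (σ : List ℕ) :
    EMetric.diam (cellAssignment α φ σ) =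
      ENNReal.ofReal (cellLength φ σ.length (binaryValue σ) + 2 * radius α σ.length) := by
  have h := cellRight_eq hφ σ.length (binaryValue σ)
  rw [cellAssignment]
  refine (Real.ediam_Ioo _ _).trans ?_
  congr 1
  linarith

lemma disjoint_cellAssignment_of_lt (hα : IsGapSeq α) (hφ : IsGapFun φ) (hφα : IsGapFunOf α φ)
    {σ τ : List ℕ} (hτ : τ ∈ binaryTree) (hl : σ.length = τ.length)
    (h : binaryValue σ < binaryValue τ) :
    Disjoint (cellAssignment α φ σ) (cellAssignment α φ τ) := by
  have hlt := binaryValue_lt hτ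
  have hlt' : binaryValue σ + 1 < 2 ^ τ.length := by omega
  have h1 := cellLeft_succ hφ hlt'
  have h2 : cellLeft φ τ.length (binaryValue σ + 1) ≤ cellLeft φ τ.length (binaryValue τ) :=
    cellLeft_le_cellLeft hφ h
  have h3 := le_gapFun_div hα hφα (Nat.succ_pos _) hlt'
  have h4 := two_mul_radius_le hα τ.length
  refine Set.disjoint_left.2 fun x hx hx' => ?_
  have h5 := hx.2
  have h6 := hx'.1
  rw [hl] at h5
  linarith

lemma closure_cellAssignment_append_subset (hα : IsGapSeq α) (hφ : IsGapFun φ) {σ : List ℕ}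
    {b : ℕ} (h : σ ++ [b] ∈ binaryTree) :
    closure (cellAssignment α φ (σ ++ [b])) ⊆ cellAssignment α φ σ := by
  rw [closure_cellAssignment hα hφ h, cellAssignment, List.length_append, List.length_singleton,
    binaryValue_append]
  have h1 := cellLeft_le_child hφ σ.length (binaryValue σ) b
  have h2 := cellRight_child_le hφ σ.length (binaryValue σ) (append_mem_binaryTree.1 h).2
  have h3 := radius_succ_lt hα σ.length
  exact Icc_subset_Ioo (by linarith) (by linarith)

lemma closure_cellAssignment_subset (hα : IsGapSeq α) (hφ : IsGapFun φ) {σ ρ : List ℕ}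
    (h : σ ++ ρ ∈ binaryTree) (hρ : ρ ≠ []) :
    closure (cellAssignment α φ (σ ++ ρ)) ⊆ cellAssignment α φ σ := by
  induction ρ using List.reverseRecOn with
  | nil => exact absurd rfl hρ
  | append_singleton ρ b ih =>
    rw [← List.append_assoc] at h ⊢
    have h1 := closure_cellAssignment_append_subset hα hφ h
    rcases eq_or_ne ρ [] with rfl | hne
    · simpa using h1
    · exact h1.trans (subset_closure.trans (ih (append_mem_binaryTree.1 h).1 hne))

lemma isAssignment_cellAssignment (hα : IsGapSeq α) (hφ : IsGapFun φ) (hφα : IsGapFunOf α φ) :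
    IsAssignment binaryTree (cellAssignment α φ) := by
  refine ⟨fun σ hσ => ⟨isOpen_Ioo, nonempty_Ioo.2 (cellAssignment_endpoints_lt hα hφ hσ)⟩,
    fun σ hσ => ?_, fun σ hσ τ hτ hne hl => ?_, fun σ _ τ hτ h hne => ?_⟩
  · rw [diam_cellAssignment hφ]
    rcases hn : σ.length with _ | n
    · simp
    · have h1 := cellLength_add_lt hα hφ hφα n (binaryValue σ)
      have h2 := two_mul_radius_le hα (n + 1)
      have h3 : (1 : ℝ≥0∞) / ((n + 1 : ℕ) : ℝ≥0∞) = ENNReal.ofReal (1 / ((n : ℝ) + 1)) := by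
        rw [ENNReal.ofReal_div_of_pos (by positivity), ENNReal.ofReal_one,
          ← ENNReal.ofReal_natCast]
        push_cast
        rfl
      rw [h3]
      exact (ENNReal.ofReal_lt_ofReal_iff (by positivity)).2 (by linarith)
  · rcases lt_trichotomy (binaryValue σ) (binaryValue τ) with h | h | h
    · exact disjoint_cellAssignment_of_lt hα hφ hφα hτ hl h
    · exact absurd (binaryValue_injective hσ hτ hl h) hne
    · exact (disjoint_cellAssignment_of_lt hα hφ hφα hσ hl.symm h).symm
  · obtain ⟨ρ, rfl⟩ := h
    refine closure_cellAssignment_subset hα hφ hτ ?_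
    rintro rfl
    simp at hne

lemma isRegularAssignment_cellAssignment (hα : IsGapSeq α) (hφ : IsGapFun φ)
    (hφα : IsGapFunOf α φ) : IsRegularAssignment binaryTree (cellAssignment α φ) := by
  intro σ hσ τ hτ hl
  rw [diam_cellAssignment hφ, diam_cellAssignment hφ, hl]
  have hlt := binaryValue_lt hτ
  have h1 : cellLength φ (τ.length + 1) (binaryValue σ) ≤
      cellLength φ τ.length (binaryValue τ) :=
    cellLength_antitone hα hφ hφα hlt (by rw [pow_succ]; omega)
  have h2 := radius_succ_lt hα τ.length
  have h3 := cellLength_nonneg hφ τ.length (binaryValue τ)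
  have h4 := radius_pos hα τ.length
  exact (ENNReal.ofReal_lt_ofReal_iff (by linarith)).2 (by linarith)

end Assignment

/-- Among disjoint order-connected subsets of the line, one that meets a ball between points of
the ball lying in two others has its closure in the ball. -/
lemma closure_subset_ball_of_between {A B C : Set ℝ} (hB : B.OrdConnected) (hAB : Disjoint A B)
    (hCB : Disjoint C B) {x r a b c : ℝ} (ha : a ∈ Metric.ball x r ∩ A) (hb : b ∈ B)
    (hc : c ∈ Metric.ball x r ∩ C) (hab : a ≤ b) (hbc : b ≤ c) :
    closure B ⊆ Metric.ball x r := by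
  have hsub : B ⊆ Icc a c := by
    intro y hy
    constructor
    · by_contra! h
      exact Set.disjoint_left.1 hAB ha.2 (hB.out hy hb ⟨h.le, hab⟩)
    · by_contra! h
      exact Set.disjoint_left.1 hCB hc.2 (hB.out hb hy ⟨hbc, h.le⟩)
  refine (closure_minimal hsub isClosed_Icc).trans ?_
  have ho : (Metric.ball x r).OrdConnected := by
    rw [Real.ball_eq_Ioo]
    exact ordConnected_Ioo
  exact ho.out ha.1 hc.1

/-- An assignment into the line by order-connected sets satisfies the 3-intersection condition. -/
lemma IsAssignment.intersectionCond_three {T : Set (List ℕ)} {f : List ℕ → Set ℝ}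
    (hf : IsAssignment T f) (ho : ∀ σ ∈ T, (f σ).OrdConnected) : IntersectionCond 3 T f := by
  intro n x r S hS hcard
  obtain ⟨ρ, hρ, σ, hσ, τ, hτ, hρσ, hρτ, hστ⟩ := Finset.two_lt_card.1 hcard
  have hdisj {μ ν : List ℕ} (hμ : μ ∈ S) (hν : ν ∈ S) (h : μ ≠ ν) : Disjoint (f μ) (f ν) :=
    hf.2.2.1 μ (hS μ hμ).1 ν (hS ν hν).1 h ((hS μ hμ).2.1.trans (hS ν hν).2.1.symm)
  have key {κ μ ν : List ℕ} (hκ : κ ∈ S) (hμ : μ ∈ S) (hν : ν ∈ S) (hκμ : κ ≠ μ) (hνμ : ν ≠ μ)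
      {a b c : ℝ} (ha : a ∈ Metric.ball x r ∩ f κ) (hb : b ∈ Metric.ball x r ∩ f μ)
      (hc : c ∈ Metric.ball x r ∩ f ν) (hab : a ≤ b) (hbc : b ≤ c) :
      ∃ σ ∈ T, σ.length = n ∧ closure (f σ) ⊆ Metric.ball x r :=
    ⟨μ, (hS μ hμ).1, (hS μ hμ).2.1, closure_subset_ball_of_between (ho μ (hS μ hμ).1)
      (hdisj hκ hμ hκμ) (hdisj hν hμ hνμ) ha hb.2 hc hab hbc⟩
  obtain ⟨a, ha⟩ := (hS ρ hρ).2.2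
  obtain ⟨b, hb⟩ := (hS σ hσ).2.2
  obtain ⟨c, hc⟩ := (hS τ hτ).2.2
  rcases le_total a b with hab | hab <;> rcases le_total b c with hbc | hbc <;>
    rcases le_total a c with hac | hac
  · exact key hρ hσ hτ hρσ hστ.symm ha hb hc hab hbc
  · exact key hρ hσ hτ hρσ hστ.symm ha hb hc hab hbc
  · exact key hρ hτ hσ hρτ hστ ha hc hb hac hbc
  · exact key hτ hρ hσ hρτ.symm hρσ.symm hc ha hb hac hab
  · exact key hσ hρ hτ hρσ.symm hρτ.symm hb ha hc hab hac
  · exact key hσ hτ hρ hστ hρτ hb hc ha hbc hac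
  · exact key hτ hσ hρ hστ.symm hρσ hc hb ha hbc hab
  · exact key hτ hσ hρ hστ.symm hρσ hc hb ha hbc hab

/-! ### The limit set -/

section LimitSet

variable {φ : ℝ → ℝ} {α : ℕ → ℝ}

/-- A cell does not meet the gaps of its level. -/
lemma notMem_gap_of_mem_cell (hφ : IsGapFun φ) {n s i : ℕ} (hi : 0 < i) (hin : i < 2 ^ n) {x : ℝ}
    (hx : x ∈ Icc (cellLeft φ n s) (cellRight φ n s)) :
    x ∉ Ioo (PhiFun φ ((i : ℝ) / 2 ^ n))
      (PhiFun φ ((i : ℝ) / 2 ^ n) + φ ((i : ℝ) / 2 ^ n)) := by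
  have e : gapMass φ (Iio ((i : ℝ) / 2 ^ n)) = PhiFun φ ((i : ℝ) / 2 ^ n) := rfl
  rintro ⟨h1, h2⟩
  rw [← e] at h1 h2
  rw [← gapMass_Iic hφ (div_mem_dyadics hi hin)] at h2
  rcases le_or_gt i s with h | h
  · have : cellLeft φ n i ≤ cellLeft φ n s := cellLeft_le_cellLeft hφ h
    exact absurd (h2.trans_le (this.trans hx.1)) (lt_irrefl _)
  · have : cellRight φ n s ≤ gapMass φ (Iio ((i : ℝ) / 2 ^ n)) := by
      refine gapMass_mono hφ (Iio_subset_Iio ?_)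
      gcongr
      exact_mod_cast h
    exact absurd (h1.trans_le (hx.2.trans this)) (lt_irrefl _)

lemma exists_child_mem_cell (hφ : IsGapFun φ) {n s : ℕ} (hs : s < 2 ^ n) {x : ℝ}
    (hx : x ∈ Icc (cellLeft φ n s) (cellRight φ n s)) (hK : x ∈ Kset φ) :
    ∃ b < 2, x ∈ Icc (cellLeft φ (n + 1) (2 * s + b)) (cellRight φ (n + 1) (2 * s + b)) := by
  have hlt : 2 * s + 1 < 2 ^ (n + 1) := by rw [pow_succ]; omega
  rcases le_or_gt x (cellRight φ (n + 1) (2 * s)) with h | h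
  · exact ⟨0, by omega, (cellLeft_two_mul n s).trans_le hx.1, h⟩
  · refine ⟨1, by omega, ?_, hx.2.trans_eq (cellRight_two_mul_add_one n s).symm⟩
    by_contra! h'
    rw [cellLeft_succ hφ hlt] at h'
    have e : cellRight φ (n + 1) (2 * s) = PhiFun φ (((2 * s + 1 : ℕ) : ℝ) / 2 ^ (n + 1)) := by
      rw [Nat.cast_succ]
      rfl
    rw [e] at h h'
    exact hK.2 (mem_iUnion₂.2 ⟨_, div_mem_dyadics (by omega) hlt, h, h'⟩)

lemma cell_subset_of_branch (hφ : IsGapFun φ) {σ : ℕ → ℕ} (hσ : σ ∈ treeBody binaryTree)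
    {n m : ℕ} (h : n ≤ m) :
    cellLeft φ n (binaryValue (List.ofFn fun i : Fin n => σ i)) ≤
        cellLeft φ m (binaryValue (List.ofFn fun i : Fin m => σ i)) ∧
      cellRight φ m (binaryValue (List.ofFn fun i : Fin m => σ i)) ≤
        cellRight φ n (binaryValue (List.ofFn fun i : Fin n => σ i)) := by
  induction m, h using Nat.le_induction with
  | base => exact ⟨le_rfl, le_rfl⟩
  | succ m _ ih =>
    have hm := hσ (m + 1)
    rw [ofFn_succ_eq_append, append_mem_binaryTree] at hm
    rw [ofFn_succ_eq_append, binaryValue_append]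
    exact ⟨ih.1.trans (cellLeft_le_child hφ _ _ _), (cellRight_child_le hφ _ _ hm.2).trans ih.2⟩

lemma mem_cell_of_mem_closure (hα : IsGapSeq α) (hφ : IsGapFun φ) {σ : ℕ → ℕ}
    (hσ : σ ∈ treeBody binaryTree) {x : ℝ}
    (hx : ∀ n : ℕ, x ∈ closure (cellAssignment α φ (List.ofFn fun i : Fin (n + 1) => σ i)))
    (n : ℕ) :
    x ∈ Icc (cellLeft φ n (binaryValue (List.ofFn fun i : Fin n => σ i)))
      (cellRight φ n (binaryValue (List.ofFn fun i : Fin n => σ i))) := by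
  have hbound (m : ℕ) (hm : n ≤ m) :
      cellLeft φ n (binaryValue (List.ofFn fun i : Fin n => σ i)) - x ≤ radius α (m + 1) ∧
        x - cellRight φ n (binaryValue (List.ofFn fun i : Fin n => σ i)) ≤ radius α (m + 1) := by
    have h1 := hx m
    rw [closure_cellAssignment hα hφ (hσ (m + 1)), List.length_ofFn] at h1
    have h2 := cell_subset_of_branch hφ hσ (Nat.le_succ_of_le hm)
    exact ⟨by linarith [h1.1, h2.1], by linarith [h1.2, h2.2]⟩
  have hlim := (tendsto_add_atTop_iff_nat 1).2 (tendsto_radius hα)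
  constructor
  · exact sub_nonpos.1 (ge_of_tendsto hlim
      (eventually_atTop.2 ⟨n, fun m hm => (hbound m hm).1⟩))
  · exact sub_nonpos.1 (ge_of_tendsto hlim
      (eventually_atTop.2 ⟨n, fun m hm => (hbound m hm).2⟩))

lemma exists_branch_of_mem_Kset (hφ : IsGapFun φ) {x : ℝ} (hx : x ∈ Kset φ) :
    ∃ σ ∈ treeBody binaryTree, ∀ n : ℕ,
      x ∈ Icc (cellLeft φ n (binaryValue (List.ofFn fun i : Fin n => σ i)))
        (cellRight φ n (binaryValue (List.ofFn fun i : Fin n => σ i))) := by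
  have hstep (n s : ℕ) : ∃ b < 2, s < 2 ^ n → x ∈ Icc (cellLeft φ n s) (cellRight φ n s) →
      x ∈ Icc (cellLeft φ (n + 1) (2 * s + b)) (cellRight φ (n + 1) (2 * s + b)) := by
    by_cases h : s < 2 ^ n ∧ x ∈ Icc (cellLeft φ n s) (cellRight φ n s)
    · obtain ⟨b, hb, hb'⟩ := exists_child_mem_cell hφ h.1 h.2 hx
      exact ⟨b, hb, fun _ _ => hb'⟩
    · exact ⟨0, by omega, fun h1 h2 => absurd ⟨h1, h2⟩ h⟩
  choose digit hdigit hcell using hstep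
  let v : ℕ → ℕ := fun n => Nat.rec 0 (fun k s => 2 * s + digit k s) n
  have hval (n : ℕ) : binaryValue (List.ofFn fun i : Fin n => digit i (v i)) = v n := by
    induction n with
    | zero => simp [binaryValue, v]
    | succ n ih => rw [ofFn_succ_eq_append (fun i => digit i (v i)), binaryValue_append, ih]
  have hbody : (fun i => digit i (v i)) ∈ treeBody binaryTree := by
    intro n b hb
    obtain ⟨i, rfl⟩ := (List.mem_ofFn' _ _).1 hb
    exact hdigit _ _
  refine ⟨_, hbody, fun n => ?_⟩
  induction n with
  | zero =>
    have h1 : cellRight φ 0 0 = 1 := cellRight_last hφ (by norm_num)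
    simpa [binaryValue, cellLeft_zero_zero, h1] using hx.1
  | succ n ih =>
    have hlt := binaryValue_lt (hbody n)
    rw [List.length_ofFn] at hlt
    rw [hval] at ih hlt ⊢
    exact hcell n (v n) hlt ih

lemma limitSet_cellAssignment (hα : IsGapSeq α) (hφ : IsGapFun φ) :
    limitSet binaryTree (cellAssignment α φ) = Kset φ := by
  ext x
  simp only [limitSet, mem_iUnion, mem_iInter, exists_prop]
  constructor
  · rintro ⟨σ, hσ, hx⟩
    have hcell := mem_cell_of_mem_closure hα hφ hσ hx
    refine ⟨?_, ?_⟩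
    · have h1 : cellRight φ 0 0 = 1 := cellRight_last hφ (by norm_num)
      simpa [binaryValue, cellLeft_zero_zero, h1] using hcell 0
    · simp only [mem_iUnion, not_exists]
      rintro d ⟨i, k, hi, -, hik, rfl⟩
      exact notMem_gap_of_mem_cell hφ hi hik (hcell k)
  · intro hx
    obtain ⟨σ, hσ, hcell⟩ := exists_branch_of_mem_Kset hφ hx
    refine ⟨σ, hσ, fun n => ?_⟩
    rw [closure_cellAssignment hα hφ (hσ (n + 1)), List.length_ofFn]
    have h1 := hcell (n + 1)
    have h2 := radius_pos hα (n + 1)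
    exact ⟨by linarith [h1.1], by linarith [h1.2]⟩

end LimitSet

/-- For `α ∈ 𝒟𝒮` there exist a 2-Cantor tree `T` and a regular `T`-assignment
`f` into `ℝ` satisfying the 3-intersection condition with `[f] = K_α`. -/
theorem stmt_5 (α : ℕ → ℝ) (hα : IsGapSeq α) (φ : ℝ → ℝ) (hφ : IsGapFun φ)
    (hφα : IsGapFunOf α φ) :
    ∃ (T : Set (List ℕ)) (f : List ℕ → Set ℝ),
      IsNCantorTree 2 T ∧ IsAssignment T f ∧ IsRegularAssignment T f ∧
      IntersectionCond 3 T f ∧ limitSet T f = Kset φ := by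
  exact ⟨binaryTree, cellAssignment α φ, isNCantorTree_binaryTree,
    isAssignment_cellAssignment hα hφ hφα, isRegularAssignment_cellAssignment hα hφ hφα,
    (isAssignment_cellAssignment hα hφ hφα).intersectionCond_three fun _ _ => ordConnected_Ioo,
    limitSet_cellAssignment hα hφ⟩
end

section
/- The collection of nonempty compact subsets of ℝ that are strongly invisible is dense in 𝒞(ℝ). -/
open Set MeasureTheory TopologicalSpace

/-- `C` is σ-finite with respect to `μ`: `C` is a countable union of Borel sets of finite
`μ`-measure. -/
def SigmaFiniteOn {G : Type*} [MeasurableSpace G] (μ : MeasureTheory.Measure G)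
    (C : Set G) : Prop :=
  ∃ s : ℕ → Set G, C = (⋃ n, s n) ∧ ∀ n, MeasurableSet (s n) ∧ μ (s n) < ⊤

/-- `C` is strongly invisible: for every translation-invariant Borel measure `μ`,
either `μ C = 0` or `C` is not σ-finite with respect to `μ`. -/
def StronglyInvisible {G : Type*} [MeasurableSpace G] [AddCommGroup G] (C : Set G) : Prop :=
  ∀ μ : MeasureTheory.Measure G,
    (∀ (t : G) (A : Set G), MeasurableSet A → μ ((fun x => x + t) '' A) = μ A) →
    μ C = 0 ∨ ¬ SigmaFiniteOn μ C

lemma SigmaFiniteOn.mono {G : Type*} [MeasurableSpace G] {μ : Measure G} {C D : Set G}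
    (h : SigmaFiniteOn μ C) (hD : MeasurableSet D) (hDC : D ⊆ C) : SigmaFiniteOn μ D := by
  obtain ⟨s, rfl, hs⟩ := h
  refine ⟨fun n => D ∩ s n, ?_, fun n => ⟨hD.inter (hs n).1, ?_⟩⟩
  · rw [← inter_iUnion, inter_eq_left.2 hDC]
  · exact (measure_mono inter_subset_right).trans_lt (hs n).2

lemma SigmaFiniteOn.measurableSet {G : Type*} [MeasurableSpace G] {μ : Measure G} {C : Set G}
    (h : SigmaFiniteOn μ C) : MeasurableSet C := by
  obtain ⟨s, rfl, hs⟩ := h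
  exact .iUnion fun n => (hs n).1

lemma SigmaFiniteOn.sigmaFinite_restrict {G : Type*} [MeasurableSpace G] {μ : Measure G}
    {C : Set G} (h : SigmaFiniteOn μ C) : SigmaFinite (μ.restrict C) := by
  have hC := h.measurableSet
  obtain ⟨s, hsC, hs⟩ := h
  refine ⟨⟨⟨fun n => s n ∪ Cᶜ, fun _ => mem_univ _, fun n => ?_, ?_⟩⟩⟩
  · rw [Measure.restrict_apply ((hs n).1.union hC.compl)]
    refine (measure_mono ?_).trans_lt (hs n).2
    rintro x ⟨hx | hx, hxC⟩
    exacts [hx, absurd hxC hx]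
  · rw [← iUnion_union, ← hsC, union_compl_self]

lemma uncountable_nat_to_bool : Uncountable (ℕ → Bool) := by
  rw [← Cardinal.aleph0_lt_mk_iff]
  simp [Cardinal.aleph0_lt_continuum]

/-- A measurable set with uncountably many pairwise disjoint translates inside a σ-finite set
is null for every translation-invariant measure. -/
lemma measure_eq_zero_of_disjoint_translates {G : Type*} [MeasurableSpace G] [AddCommGroup G]
    [MeasurableAdd G] {μ : Measure G}
    (hμ : ∀ (t : G) (A : Set G), MeasurableSet A → μ ((fun x => x + t) '' A) = μ A)
    {C B : Set G} (hC : SigmaFiniteOn μ C) (hB : MeasurableSet B)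
    {ι : Type*} [Uncountable ι] (T : ι → G) (hT : ∀ i, ∀ x ∈ B, x + T i ∈ C)
    (hdisj : ∀ i j, ∀ x ∈ B, ∀ y ∈ B, x + T i = y + T j → i = j) : μ B = 0 := by
  by_contra h0
  have := hC.sigmaFinite_restrict
  have hmeas : ∀ i, MeasurableSet ((fun x => x + T i) '' B) := fun i =>
    (MeasurableEquiv.addRight (T i)).measurableSet_image.2 hB
  have hcount := Measure.countable_meas_pos_of_disjoint_iUnion (μ := μ.restrict C) hmeas (by
    intro i j hij
    refine disjoint_left.2 ?_
    rintro _ ⟨x, hx, rfl⟩ ⟨y, hy, hxy⟩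
    exact hij (hdisj i j x hx y hy hxy.symm))
  refine not_countable_univ (α := ι) (hcount.mono fun i _ => ?_)
  rw [mem_ofPred_eq, Measure.restrict_apply (hmeas i), inter_eq_left.2, hμ _ _ hB]
  · exact pos_iff_ne_zero.2 h0
  · rintro _ ⟨x, hx, rfl⟩
    exact hT i x hx

/-- A finite union of translates of a strongly invisible set is strongly invisible. -/
lemma StronglyInvisible.biUnion_translates {G : Type*} [MeasurableSpace G] [AddCommGroup G]
    [MeasurableAdd G] {C F : Set G} (h : StronglyInvisible C) (hC : MeasurableSet C)
    (hF : F.Finite) : StronglyInvisible (⋃ f ∈ F, (fun x => x + f) '' C) := by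
  intro μ hμ
  rw [or_iff_not_imp_right, not_not]
  intro hσ
  refine (measure_biUnion_null_iff hF.countable).2 fun f hf => ?_
  rw [hμ f C hC]
  refine (h μ hμ).resolve_right (not_not.2 ?_)
  obtain ⟨s, hs, hfin⟩ := hσ.mono ((MeasurableEquiv.addRight f).measurableSet_image.2 hC)
    (subset_biUnion_of_mem (u := fun f => (fun x => x + f) '' C) hf)
  have hm : ∀ n, MeasurableSet ((fun x => x + -f) '' s n) := fun n =>
    (MeasurableEquiv.addRight (-f)).measurableSet_image.2 (hfin n).1
  refine ⟨fun n => (fun x => x + -f) '' s n, ?_, fun n => ⟨hm n, ?_⟩⟩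
  · rw [← image_iUnion, ← hs, image_image]
    simp
  · rw [hμ _ _ (hfin n).1]
    exact (hfin n).2

/-- The real number with digits `x m` at the superexponentially small scales `2 ^ (-3 m ^ 2)`. -/
noncomputable def lacunarySum (x : ℕ → ℕ) : ℝ := ∑' m, (x m : ℝ) * (1 / 2) ^ (3 * m ^ 2)

lemma lacunary_term_le {x : ℕ → ℕ} (m : ℕ) (hx : x m ≤ 2 ^ m) :
    (x m : ℝ) * (1 / 2) ^ (3 * m ^ 2) ≤ (1 / 2) ^ m := by
  have h1 : (x m : ℝ) ≤ 2 ^ m := by exact_mod_cast hx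
  have h2 : ((1 : ℝ) / 2) ^ (3 * m ^ 2) ≤ (1 / 2) ^ (m + m) :=
    pow_le_pow_of_le_one (by norm_num) (by norm_num) (by nlinarith [Nat.le_self_pow two_ne_zero m])
  calc (x m : ℝ) * (1 / 2) ^ (3 * m ^ 2) ≤ 2 ^ m * (1 / 2) ^ (m + m) := by gcongr
    _ = (1 / 2) ^ m := by rw [pow_add, ← mul_assoc, ← mul_pow]; norm_num

lemma summable_lacunary {x : ℕ → ℕ} (hx : ∀ m, x m ≤ 2 ^ m) :
    Summable fun m => (x m : ℝ) * (1 / 2) ^ (3 * m ^ 2) :=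
  summable_geometric_two.of_nonneg_of_le (fun _ => by positivity)
    fun m => lacunary_term_le m (hx m)

lemma lacunarySum_nonneg (x : ℕ → ℕ) : 0 ≤ lacunarySum x :=
  tsum_nonneg fun _ => by positivity

lemma lacunarySum_le_two {x : ℕ → ℕ} (hx : ∀ m, x m ≤ 2 ^ m) : lacunarySum x ≤ 2 := by
  rw [← tsum_geometric_two]
  exact (summable_lacunary hx).tsum_le_tsum (fun m => lacunary_term_le m (hx m))
    summable_geometric_two

lemma lacunarySum_add {x y : ℕ → ℕ} (hx : ∀ m, x m ≤ 2 ^ m) (hy : ∀ m, y m ≤ 2 ^ m) :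
    lacunarySum (x + y) = lacunarySum x + lacunarySum y := by
  unfold lacunarySum
  rw [← (summable_lacunary hx).tsum_add (summable_lacunary hy)]
  simp [add_mul]

lemma lacunary_tail_le {x : ℕ → ℕ} (hx : ∀ m, x m ≤ 2 ^ m) (n : ℕ) :
    ∑' i, (x (i + (n + 1)) : ℝ) * (1 / 2) ^ (3 * (i + (n + 1)) ^ 2) ≤
      (1 / 2) * (1 / 2) ^ (3 * n ^ 2) := by
  have hterm : ∀ i, (x (i + (n + 1)) : ℝ) * (1 / 2) ^ (3 * (i + (n + 1)) ^ 2) ≤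
      (1 / 2) ^ (3 * n ^ 2 + 1) / 2 / 2 ^ i := by
    intro i
    have h1 : (x (i + (n + 1)) : ℝ) ≤ 2 ^ (i + (n + 1)) := by exact_mod_cast hx _
    have h2 : ((1 : ℝ) / 2) ^ (3 * (i + (n + 1)) ^ 2) ≤
        (1 / 2) ^ ((i + (n + 1)) + (3 * n ^ 2 + 1 + 1 + i)) :=
      pow_le_pow_of_le_one (by norm_num) (by norm_num) (by nlinarith [Nat.zero_le (i * n)])
    calc (x (i + (n + 1)) : ℝ) * (1 / 2) ^ (3 * (i + (n + 1)) ^ 2)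
        ≤ 2 ^ (i + (n + 1)) * (1 / 2) ^ ((i + (n + 1)) + (3 * n ^ 2 + 1 + 1 + i)) := by gcongr
      _ = (1 / 2) ^ (3 * n ^ 2 + 1) / 2 / 2 ^ i := by
        rw [pow_add (1 / 2 : ℝ) (i + (n + 1)), ← mul_assoc, ← mul_pow, pow_add _ _ i,
          pow_succ _ (3 * n ^ 2 + 1), one_div_pow _ i]
        norm_num [div_eq_mul_inv]
  refine (Summable.tsum_le_tsum hterm ?_ (summable_geometric_two' _)).trans_eq ?_
  · exact (summable_lacunary hx).comp_injective (add_left_injective (n + 1))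
  · rw [tsum_geometric_two', pow_succ, mul_comm]

lemma lacunarySum_lt {x y : ℕ → ℕ} (hx : ∀ m, x m ≤ 2 ^ m) (hy : ∀ m, y m ≤ 2 ^ m) {n : ℕ}
    (heq : ∀ m < n, x m = y m) (hlt : x n < y n) : lacunarySum x < lacunarySum y := by
  unfold lacunarySum
  rw [← (summable_lacunary hx).sum_add_tsum_nat_add (n + 1),
    ← (summable_lacunary hy).sum_add_tsum_nat_add (n + 1), Finset.sum_range_succ,
    Finset.sum_range_succ, Finset.sum_congr rfl fun m hm => by rw [heq m (Finset.mem_range.1 hm)]]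
  have h1 := lacunary_tail_le hx n
  have h2 : 0 ≤ ∑' i, (y (i + (n + 1)) : ℝ) * (1 / 2) ^ (3 * (i + (n + 1)) ^ 2) :=
    tsum_nonneg fun _ => by positivity
  have h3 : (x n : ℝ) + 1 ≤ y n := by exact_mod_cast hlt
  have h4 : (0 : ℝ) < (1 / 2) ^ (3 * n ^ 2) := by positivity
  nlinarith

lemma lacunarySum_injOn : InjOn lacunarySum {x | ∀ m, x m ≤ 2 ^ m} := by
  intro x hx y hy hxy
  funext n
  induction n using Nat.strong_induction_on with
  | _ n ih =>
    rcases lt_trichotomy (x n) (y n) with h | h | h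
    · exact absurd hxy (lacunarySum_lt hx hy ih h).ne
    · exact h
    · exact absurd hxy (lacunarySum_lt hy hx (fun m hm => (ih m hm).symm) h).ne'

lemma continuousOn_lacunarySum : ContinuousOn lacunarySum {x | ∀ m, x m ≤ 2 ^ m} := by
  refine continuousOn_tsum (fun m => ?_) summable_geometric_two fun m x hx => ?_
  · exact ((continuous_of_discreteTopology (f := fun n : ℕ => (n : ℝ))).comp
      (continuous_apply m)).continuousOn.mul continuousOn_const
  · rw [Real.norm_of_nonneg (by positivity)]
    exact lacunary_term_le m (hx m)

/-- Digit sequences whose entries are all bounded in terms of the position of the first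
nonzero entry. -/
def digitSet : Set (ℕ → ℕ) := {x | ∀ k m, x k ≠ 0 → x m < 2 ^ k}

/-- Digit sequences bounded by `2 ^ k`, vanishing before position `k` and equal to `v` there. -/
def digitPiece (k v : ℕ) : Set (ℕ → ℕ) := {x | (∀ j < k, x j = 0) ∧ x k = v ∧ ∀ m, x m < 2 ^ k}

lemma digitSet_subset_le : digitSet ⊆ {x | ∀ m, x m ≤ 2 ^ m} := by
  intro x hx m
  by_cases h : x m = 0
  · simp [h]
  · exact (hx m m h).le

lemma digitPiece_subset (k v : ℕ) : digitPiece k v ⊆ digitSet := by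
  rintro x ⟨h0, -, hlt⟩ j m hj
  have : k ≤ j := not_lt.1 fun h => hj (h0 j h)
  exact (hlt m).trans_le (Nat.pow_le_pow_right two_pos this)

lemma digitSet_subset_iUnion : digitSet ⊆ ⋃ p : ℕ × ℕ, digitPiece p.1 p.2 := by
  intro x hx
  by_cases h : ∃ k, x k ≠ 0
  · refine mem_iUnion.2 ⟨(Nat.find h, x (Nat.find h)), fun j hj => ?_, rfl,
      fun m => hx _ m (Nat.find_spec h)⟩
    exact not_not.1 (Nat.find_min h hj)
  · push Not at h
    exact mem_iUnion.2 ⟨(0, 0), by simp [digitPiece, h]⟩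

lemma isCompact_digitSet : IsCompact digitSet := by
  have hc : IsCompact (univ.pi fun m : ℕ => Iic (2 ^ m)) :=
    isCompact_univ_pi fun m => (finite_Iic _).isCompact
  refine hc.of_isClosed_subset ?_ fun x hx m _ => digitSet_subset_le hx m
  simp only [digitSet, ofPred_forall]
  refine isClosed_iInter fun k => isClosed_iInter fun m => ?_
  have hcont : Continuous fun x : ℕ → ℕ => (x k, x m) := by fun_prop
  exact (isClosed_discrete {p : ℕ × ℕ | p.1 ≠ 0 → p.2 < 2 ^ k}).preimage hcont

lemma isCompact_digitPiece (k v : ℕ) : IsCompact (digitPiece k v) := by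
  refine isCompact_digitSet.of_isClosed_subset ?_ (digitPiece_subset k v)
  have hcont : ∀ j, Continuous fun x : ℕ → ℕ => x j := continuous_apply
  simp only [digitPiece, ofPred_and, ofPred_forall]
  refine .inter (isClosed_iInter fun j => isClosed_iInter fun _ => ?_)
    (.inter ?_ (isClosed_iInter fun m => ?_))
  · exact (isClosed_discrete {0}).preimage (hcont j)
  · exact (isClosed_discrete {v}).preimage (hcont k)
  · exact (isClosed_discrete (Iio (2 ^ k))).preimage (hcont m)

/-- The digit sequence with entries `0` or `2 ^ k`, according to `e`, after position `k`. -/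
def shiftDigits (k : ℕ) (e : ℕ → Bool) (m : ℕ) : ℕ :=
  if m ≤ k then 0 else if e (m - (k + 1)) then 2 ^ k else 0

/-- Erase the digit at `k` and add `shiftDigits k e`. -/
def shifted (k : ℕ) (e : ℕ → Bool) (x : ℕ → ℕ) (m : ℕ) : ℕ :=
  if m ≤ k then 0 else x m + shiftDigits k e m

lemma shifted_mem_digitSet {k v : ℕ} (e : ℕ → Bool) {x : ℕ → ℕ} (hx : x ∈ digitPiece k v) :
    shifted k e x ∈ digitSet := by
  refine digitPiece_subset (k + 1) (shifted k e x (k + 1)) ⟨fun j hj => ?_, rfl, fun m => ?_⟩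
  · simp [shifted, Nat.lt_succ_iff.1 hj]
  · have := hx.2.2 m
    unfold shifted shiftDigits
    split_ifs <;> simp [pow_succ] <;> omega

lemma shifted_injective {k v : ℕ} {e e' : ℕ → Bool} {x y : ℕ → ℕ} (hx : x ∈ digitPiece k v)
    (hy : y ∈ digitPiece k v) (h : shifted k e x = shifted k e' y) : e = e' := by
  funext i
  have hi := congrFun h (i + (k + 1))
  have h1 := hx.2.2 (i + (k + 1))
  have h2 := hy.2.2 (i + (k + 1))
  have h3 : ¬ i + (k + 1) ≤ k := by omega
  simp only [shifted, shiftDigits, h3, if_false, Nat.add_sub_cancel] at hi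
  cases he : e i <;> cases he' : e' i <;> simp [he, he'] at hi ⊢ <;> omega

lemma lacunarySum_shifted {k v : ℕ} (e : ℕ → Bool) {x : ℕ → ℕ} (hx : x ∈ digitPiece k v) :
    lacunarySum (shifted k e x) =
      lacunarySum x + (lacunarySum (shiftDigits k e) - lacunarySum (Pi.single k v)) := by
  have hs : ∀ m, shiftDigits k e m ≤ 2 ^ m := by
    intro m
    unfold shiftDigits
    split_ifs with h1
    · exact Nat.zero_le _
    · exact Nat.pow_le_pow_right two_pos (by omega)
    · exact Nat.zero_le _
  have hv : ∀ m, (Pi.single k v : ℕ → ℕ) m ≤ 2 ^ m := by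
    intro m
    rcases eq_or_ne m k with rfl | h
    · simpa [← hx.2.1] using (hx.2.2 m).le
    · simp [h]
  have key : shifted k e x + Pi.single k v = x + shiftDigits k e := by
    funext m
    rcases lt_trichotomy m k with h | rfl | h
    · simp [shifted, shiftDigits, h.le, h.ne, hx.1 m h]
    · simp [shifted, shiftDigits, hx.2.1]
    · simp [shifted, h.not_ge, h.ne']
  have := congrArg lacunarySum key
  rw [lacunarySum_add (digitSet_subset_le (shifted_mem_digitSet e hx)) hv,
    lacunarySum_add (digitSet_subset_le (digitPiece_subset k v hx)) hs] at this
  linarith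

/-- The compact set of reals `c * lacunarySum x` with digits `x` in `digitSet`. -/
def invisibleSet (c : ℝ) : Set ℝ := (fun x => c * lacunarySum x) '' digitSet

lemma isCompact_invisibleSet (c : ℝ) : IsCompact (invisibleSet c) :=
  isCompact_digitSet.image_of_continuousOn
    (continuousOn_const.mul (continuousOn_lacunarySum.mono digitSet_subset_le))

lemma zero_mem_invisibleSet (c : ℝ) : 0 ∈ invisibleSet c :=
  ⟨0, fun k m h => absurd rfl h, by simp [lacunarySum]⟩

lemma abs_le_of_mem_invisibleSet {c y : ℝ} (hc : 0 ≤ c) (hy : y ∈ invisibleSet c) :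
    |y| ≤ c * 2 := by
  obtain ⟨x, hx, rfl⟩ := hy
  rw [abs_of_nonneg (mul_nonneg hc (lacunarySum_nonneg x))]
  exact mul_le_mul_of_nonneg_left (lacunarySum_le_two (digitSet_subset_le hx)) hc

lemma stronglyInvisible_invisibleSet {c : ℝ} (hc : c ≠ 0) :
    StronglyInvisible (invisibleSet c) := by
  intro μ hμ
  rw [or_iff_not_imp_right, not_not]
  intro hσ
  have hcover : invisibleSet c ⊆
      ⋃ p : ℕ × ℕ, (fun x => c * lacunarySum x) '' digitPiece p.1 p.2 := by
    rw [← image_iUnion]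
    exact image_mono digitSet_subset_iUnion
  refine measure_mono_null hcover (measure_iUnion_null fun p => ?_)
  obtain ⟨k, v⟩ := p
  have hcont : ContinuousOn (fun x => c * lacunarySum x) (digitPiece k v) :=
    continuousOn_const.mul (continuousOn_lacunarySum.mono
      ((digitPiece_subset k v).trans digitSet_subset_le))
  have hshift : ∀ e, ∀ x ∈ digitPiece k v, c * lacunarySum x +
      c * (lacunarySum (shiftDigits k e) - lacunarySum (Pi.single k v)) =
        c * lacunarySum (shifted k e x) := fun e x hx => by
    rw [lacunarySum_shifted e hx, mul_add]
  have := uncountable_nat_to_bool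
  refine measure_eq_zero_of_disjoint_translates hμ hσ
    ((isCompact_digitPiece k v).image_of_continuousOn hcont).measurableSet
    (fun e => c * (lacunarySum (shiftDigits k e) - lacunarySum (Pi.single k v))) ?_ ?_
  · rintro e _ ⟨x, hx, rfl⟩
    exact ⟨_, shifted_mem_digitSet e hx, (hshift e x hx).symm⟩
  · rintro e e' _ ⟨x, hx, rfl⟩ _ ⟨y, hy, rfl⟩ hxy
    simp only [hshift e x hx, hshift e' y hy] at hxy
    exact shifted_injective hx hy (lacunarySum_injOn
      (digitSet_subset_le (shifted_mem_digitSet e hx))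
      (digitSet_subset_le (shifted_mem_digitSet e' hy)) (mul_left_cancel₀ hc hxy))

/-- The collection of nonempty compact subsets of `ℝ` that are strongly
invisible is dense in `𝒞(ℝ)`. -/
theorem stmt_15 : Dense {K : NonemptyCompacts ℝ | StronglyInvisible (K : Set ℝ)} := by
  rw [Metric.dense_iff]
  intro K r hr
  obtain ⟨F, hFK, hF, hcover⟩ := K.isCompact.finite_cover_balls (half_pos hr)
  have hcpt := isCompact_invisibleSet (r / 4)
  have hcompact : IsCompact (⋃ f ∈ F, (fun x => x + f) '' invisibleSet (r / 4)) :=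
    hF.isCompact_biUnion fun f _ => hcpt.image (continuous_add_const f)
  have hmem : ∀ f ∈ F, f ∈ ⋃ f ∈ F, (fun x => x + f) '' invisibleSet (r / 4) := fun f hf =>
    mem_biUnion hf ⟨0, zero_mem_invisibleSet _, zero_add f⟩
  have hnear : ∀ x ∈ K, ∃ f ∈ F, dist x f < r / 2 := fun x hx => by
    simpa using hcover hx
  obtain ⟨x₀, hx₀⟩ := K.nonempty
  obtain ⟨f₀, hf₀, -⟩ := hnear x₀ hx₀
  refine ⟨⟨⟨_, hcompact⟩, f₀, hmem f₀ hf₀⟩, ?_,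
    (stronglyInvisible_invisibleSet (by positivity)).biUnion_translates hcpt.measurableSet hF⟩
  rw [Metric.mem_ball, Metric.NonemptyCompacts.dist_eq]
  refine (Metric.hausdorffDist_le_of_mem_dist (half_pos hr).le ?_ ?_).trans_lt (half_lt_self hr)
  · intro y hy
    obtain ⟨f, hf, x, hx, rfl⟩ := mem_iUnion₂.1 hy
    refine ⟨f, hFK hf, ?_⟩
    have := abs_le_of_mem_invisibleSet (by positivity) hx
    rw [Real.dist_eq, add_sub_cancel_right]
    linarith
  · intro x hx
    obtain ⟨f, hf, hxf⟩ := hnear x hx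
    exact ⟨f, hmem f hf, hxf.le⟩
end
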